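/- Let G = Paut(f) be the projective automorphism group of a nonsingular quartic form f ∈ k[x,y,z,t] over an algebraically closed field k of characteristic zero. Then 25 does not divide |G|; i.e., in the prime factorization of |G|, the exponent of 5 is at most 1. -/

import Mathlib

open MvPolynomial

/-- A quartic form in `k[x,y,z,t]` is singular if its four partial derivatives have a common
zero in `k⁴ \ {0}`. -/
def MvPolynomial.IsSingularForm {k : Type*} [CommRing k] (f : MvPolynomial (Fin 4) k) : Prop :=
  ∃ p : Fin 4 → k, p ≠ 0 ∧ ∀ i : Fin 4, eval p (pderiv i f) = 0

/-- The linear substitution action of a matrix on polynomials: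
`substM A f = f ∘ A`, i.e. `x_i ↦ ∑ j, A i j * x_j`. -/
noncomputable def substM {k : Type*} [CommSemiring k] (A : Matrix (Fin 4) (Fin 4) k)
    (f : MvPolynomial (Fin 4) k) : MvPolynomial (Fin 4) k :=
  aeval (fun i => ∑ j : Fin 4, MvPolynomial.C (A i j) * X j) f

/-- `(A) ∈ PGL₄(k)` is a projective automorphism of the form `f` if the substitution by
`A⁻¹` sends `f` to a nonzero scalar multiple of itself. -/
def IsProjAut {k : Type*} [Field k] (f : MvPolynomial (Fin 4) k)
    (A : Matrix.GeneralLinearGroup (Fin 4) k) : Prop :=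
  ∃ c : kˣ, substM (↑(A⁻¹) : Matrix (Fin 4) (Fin 4) k) f = (c : k) • f

/-- The number of projective automorphisms of `f`, i.e. `|Paut(f)|`, counted as a subset of
`PGL₄(k) = GL₄(k)/center`. -/
noncomputable def pautCard {k : Type*} [Field k] (f : MvPolynomial (Fin 4) k) : ℕ :=
  Nat.card {x : Matrix.GeneralLinearGroup (Fin 4) k ⧸
      Subgroup.center (Matrix.GeneralLinearGroup (Fin 4) k) //
    ∃ A : Matrix.GeneralLinearGroup (Fin 4) k, QuotientGroup.mk A = x ∧ IsProjAut f A}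

theorem Module.End.HasEigenvector.pow_eq_one {k V : Type*} [Field k] [AddCommGroup V] [Module k V]
    {A : Module.End k V} {a : k} {v : V} (hv : A.HasEigenvector a v) {n : ℕ} (hA : A ^ n = 1) :
    a ^ n = 1 := by
  have h := hv.pow_apply n
  rw [hA, Module.End.one_apply] at h
  have h0 : (a ^ n - 1) • v = 0 := by rw [sub_smul, one_smul, ← h, sub_self]
  exact sub_eq_zero.mp ((smul_eq_zero.mp h0).resolve_right hv.2)

section Quadrilinear

open Module

variable {k V : Type*} [Field k] [AddCommGroup V] [Module k V]

/-- A symmetric quadrilinear form `F` whose associated quartic form `x ↦ F x x x x` is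
nonsingular. -/
structure IsSmoothQuadrilinear (F : V →ₗ[k] V →ₗ[k] V →ₗ[k] V →ₗ[k] k) : Prop where
  swap₁₂ : ∀ x y z w, F x y z w = F y x z w
  swap₂₃ : ∀ x y z w, F x y z w = F x z y w
  swap₃₄ : ∀ x y z w, F x y z w = F x y w z
  smooth : ∀ p, p ≠ 0 → ∃ w, F p p p w ≠ 0

/-- The endomorphism `A` preserves the quadrilinear form `F`. -/
def PreservesForm (F : V →ₗ[k] V →ₗ[k] V →ₗ[k] V →ₗ[k] k) (A : End k V) : Prop :=
  ∀ x y z w, F (A x) (A y) (A z) (A w) = F x y z w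

variable {F : V →ₗ[k] V →ₗ[k] V →ₗ[k] V →ₗ[k] k} {A B : End k V}

namespace PreservesForm

theorem one : PreservesForm F (1 : End k V) := fun _ _ _ _ => rfl

theorem mul (hA : PreservesForm F A) (hB : PreservesForm F B) : PreservesForm F (A * B) :=
  fun x y z w => (hA _ _ _ _).trans (hB x y z w)

theorem pow (hA : PreservesForm F A) (n : ℕ) : PreservesForm F (A ^ n) := by
  induction n with
  | zero => exact one
  | succ n ih => rw [pow_succ]; exact ih.mul hA

theorem ne_zero_of_hasEigenvalue (hF : IsSmoothQuadrilinear F) (hA : PreservesForm F A) {a : k}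
    (ha : A.HasEigenvalue a) : a ≠ 0 := by
  rintro rfl
  obtain ⟨v, hv⟩ := ha.exists_hasEigenvector
  obtain ⟨w, hw⟩ := hF.smooth v hv.2
  apply hw
  rw [← hA, hv.apply_eq_smul]
  simp

variable [FiniteDimensional k V]

/-- The set of eigenvalues is stable under `a ↦ a⁻³`. -/
theorem hasEigenvalue_inv_pow_three (hF : IsSmoothQuadrilinear F) (hA : PreservesForm F A) {a : k}
    (ha : A.HasEigenvalue a) : A.HasEigenvalue (a ^ 3)⁻¹ := by
  have ha0 := hA.ne_zero_of_hasEigenvalue hF ha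
  obtain ⟨v, hv⟩ := ha.exists_hasEigenvector
  obtain ⟨w, hw⟩ := hF.smooth v hv.2
  by_contra hne
  have hinj : Function.Injective (A - algebraMap k (End k V) (a ^ 3)⁻¹) := by
    rw [← LinearMap.ker_eq_bot, Algebra.algebraMap_eq_smul_one, ← Module.End.eigenspace_def]
    rwa [Module.End.hasEigenvalue_iff, not_not] at hne
  obtain ⟨u, hu⟩ := LinearMap.injective_iff_surjective.mp hinj w
  apply hw
  have h := hA v v v u
  rw [hv.apply_eq_smul] at h
  simp only [map_smul, LinearMap.smul_apply, smul_eq_mul] at h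
  rw [← hu]
  simp only [LinearMap.sub_apply, Module.algebraMap_end_apply, map_sub, map_smul, smul_eq_mul]
  rw [← h]
  field_simp
  ring

/-- The eigenvalues are closed under the iterates of `a ↦ a⁻³`. -/
theorem hasEigenvalue_zpow (hF : IsSmoothQuadrilinear F) (hA : PreservesForm F A) {a : k}
    (ha : A.HasEigenvalue a) (n : ℕ) : A.HasEigenvalue (a ^ ((-3 : ℤ) ^ n)) := by
  induction n with
  | zero => simpa using ha
  | succ n ih =>
    convert hA.hasEigenvalue_inv_pow_three hF ih using 1
    rw [pow_succ, zpow_mul, zpow_neg]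
    norm_cast

end PreservesForm

theorem card_hasEigenvalue_le [FiniteDimensional k V] (s : Finset k)
    (hs : ∀ a ∈ s, A.HasEigenvalue a) : s.card ≤ finrank k V := by
  classical
  rw [← LinearMap.charpoly_natDegree A]
  refine (Finset.card_le_card (t := A.charpoly.roots.toFinset) fun a ha => ?_).trans
    ((Multiset.toFinset_card_le _).trans (Polynomial.card_roots' _))
  simpa [A.charpoly_monic.ne_zero] using
    (Module.End.hasEigenvalue_iff_isRoot_charpoly A a).mp (hs a ha)

namespace PreservesForm

variable [FiniteDimensional k V]

theorem eigenvalue_pow_eq_one (hF : IsSmoothQuadrilinear F) (hdim : finrank k V = 4)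
    (hA : PreservesForm F A) {a : k} (ha : A.HasEigenvalue a) : a ^ 15120 = 1 := by
  classical
  have ha0 := hA.ne_zero_of_hasEigenvalue hF ha
  have hninj : ¬ Function.Injective fun n : Fin 5 => a ^ ((-3 : ℤ) ^ (n : ℕ)) := by
    intro hinj
    have h := card_hasEigenvalue_le (A := A)
      (Finset.univ.image fun n : Fin 5 => a ^ ((-3 : ℤ) ^ (n : ℕ))) (by
        intro b hb
        obtain ⟨n, -, rfl⟩ := Finset.mem_image.mp hb
        exact hA.hasEigenvalue_zpow hF ha n)
    rw [Finset.card_image_of_injective _ hinj, hdim] at h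
    simp at h
  simp only [Function.Injective, not_forall] at hninj
  obtain ⟨m, n, hmn, hne⟩ := hninj
  have hdvd : ∀ m n : Fin 5, m ≠ n → ((-3 : ℤ) ^ (m : ℕ) - (-3) ^ (n : ℕ)) ∣ 15120 := by
    decide
  obtain ⟨c, hc⟩ := hdvd m n hne
  have h1 : a ^ ((-3 : ℤ) ^ (m : ℕ) - (-3) ^ (n : ℕ)) = 1 := by
    rw [zpow_sub₀ ha0, hmn, div_self (zpow_ne_zero _ ha0)]
  have h2 : a ^ (15120 : ℤ) = 1 := by rw [hc, zpow_mul, h1, one_zpow]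
  exact_mod_cast h2

end PreservesForm

theorem pow_finrank_eq_zero_of_hasEigenvalue [IsAlgClosed k] [FiniteDimensional k V]
    (h : ∀ a, A.HasEigenvalue a → a = 0) : A ^ finrank k V = 0 := by
  have hroots : A.charpoly.roots = Multiset.replicate (finrank k V) 0 := by
    rw [Multiset.eq_replicate]
    refine ⟨?_, fun a ha => h a ?_⟩
    · rw [← (IsAlgClosed.splits A.charpoly).natDegree_eq_card_roots, LinearMap.charpoly_natDegree]
    · rw [Module.End.hasEigenvalue_iff_isRoot_charpoly]
      exact Polynomial.isRoot_of_mem_roots ha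
  have hX : A.charpoly = Polynomial.X ^ finrank k V := by
    rw [(IsAlgClosed.splits A.charpoly).eq_prod_roots_of_monic A.charpoly_monic, hroots]
    simp
  simpa [hX] using A.aeval_self_charpoly

theorem exists_smul_of_pow_three_ne_zero [FiniteDimensional k V] (hdim : finrank k V = 4)
    (h4 : A ^ 4 = 0) {v : V} (hv : (A ^ 3) v ≠ 0) (w : V) : ∃ c : k, (A ^ 3) w = c • (A ^ 3) v := by
  have hz : ∀ n, 4 ≤ n → ∀ x, (A ^ n) x = 0 := fun n hn x => by
    rw [pow_eq_zero_of_le hn h4, LinearMap.zero_apply]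
  have hA : ∀ m n x, (A ^ m) ((A ^ n) x) = (A ^ (m + n)) x := fun m n x => by
    rw [pow_add, Module.End.mul_apply]
  have hA' : ∀ n x, (A ^ n) (A x) = (A ^ (n + 1)) x := fun n x => hA n 1 x
  have hli : LinearIndependent k fun i : Fin 4 => (A ^ (i : ℕ)) v := by
    rw [Fintype.linearIndependent_iff]
    intro g hg
    have key : ∀ n, (A ^ n) (∑ i, g i • (A ^ (i : ℕ)) v) = 0 := fun n => by rw [hg, map_zero]
    simp only [Fin.sum_univ_four, map_add, map_smul, hA] at key
    have e0 : g 0 = 0 := by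
      have := key 3
      simpa [hz, hv] using this
    have e1 : g 1 = 0 := by
      have := key 2
      simpa [hz, hv, e0] using this
    have e2 : g 2 = 0 := by
      have := key 1
      simpa [hz, hv, e0, e1] using this
    have e3 : g 3 = 0 := by
      have := key 0
      simpa [hz, hv, e0, e1, e2] using this
    intro i
    fin_cases i <;> assumption
  have hspan := hli.span_eq_top_of_card_eq_finrank (by simp [hdim])
  obtain ⟨c, hc⟩ := (Submodule.mem_span_range_iff_exists_fun k).mp
    (hspan ▸ Submodule.mem_top : w ∈ Submodule.span k _)
  refine ⟨c 0, ?_⟩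
  rw [← hc]
  simp [Fin.sum_univ_four, hA, hA', hz]

/-- A nonzero nilpotent endomorphism of a four-dimensional space has a Jordan chain `u ↦ p ↦ 0`
whose end `p` spans the image of the third power. -/
theorem exists_chain_end [FiniteDimensional k V] (hdim : finrank k V = 4) (h4 : A ^ 4 = 0)
    (hA : A ≠ 0) : ∃ u, A u ≠ 0 ∧ A (A u) = 0 ∧ ∀ w, ∃ c : k, (A ^ 3) w = c • A u := by
  have hc : ∀ n x, A ((A ^ n) x) = (A ^ (n + 1)) x := fun n x => by
    rw [pow_succ', Module.End.mul_apply]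
  by_cases h3 : A ^ 3 = 0
  · by_cases h2 : A ^ 2 = 0
    · obtain ⟨v, hv⟩ := DFunLike.ne_iff.mp hA
      exact ⟨v, hv, by simpa [h2] using hc 1 v, fun w => ⟨0, by simp [h3]⟩⟩
    · obtain ⟨v, hv⟩ := DFunLike.ne_iff.mp h2
      refine ⟨A v, ?_, ?_, fun w => ⟨0, by simp [h3]⟩⟩
      · simpa [pow_two] using hv
      · have := hc 2 v
        simpa [h3, pow_two] using this
  · obtain ⟨v, hv⟩ := DFunLike.ne_iff.mp h3
    refine ⟨(A ^ 2) v, ?_, ?_, fun w => ?_⟩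
    · rw [hc]; exact hv
    · rw [hc, hc, h4, LinearMap.zero_apply]
    · obtain ⟨c, hc'⟩ := exists_smul_of_pow_three_ne_zero hdim h4 hv w
      exact ⟨c, by rw [hc', hc]⟩

namespace PreservesForm

variable [FiniteDimensional k V] [CharZero k]

theorem eq_one_of_sub_one_pow_four (hF : IsSmoothQuadrilinear F) (hdim : finrank k V = 4)
    (hA : PreservesForm F A) (h4 : (A - 1) ^ 4 = 0) : A = 1 := by
  by_contra hne
  obtain ⟨N, rfl⟩ : ∃ N, A = 1 + N := ⟨A - 1, by abel⟩
  rw [add_sub_cancel_left] at h4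
  have hN : N ≠ 0 := by rintro rfl; exact hne (add_zero 1)
  obtain ⟨u, hp, hNp, hspan⟩ := exists_chain_end hdim h4 hN
  obtain ⟨w, hw⟩ := hF.smooth _ hp
  apply hw
  have hN4 : ∀ x, N (N (N (N x))) = 0 := fun x => by simpa [pow_succ] using congr($h4 x)
  have hN3 : ∀ x, ∃ c : k, N (N (N x)) = c • N u := fun x => by simpa [pow_succ] using hspan x
  generalize hpu : N u = p at *
  have r1 : ∀ x, F p p p x + F p p p (N x) + F u p p (N x) = 0 := fun x => by
    have := hA u p p x
    simp only [LinearMap.add_apply, Module.End.one_apply, hpu, hNp, map_add, add_zero] at this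
    linear_combination this
  have r2 : ∀ x, F p p p x + F p p p (N x) + 2 * (F u p p x + F u p p (N x)) + F u u p (N x) = 0 :=
    fun x => by
    have := hA u u p x
    simp only [LinearMap.add_apply, Module.End.one_apply, hpu, hNp, map_add, add_zero] at this
    linear_combination this - hF.swap₁₂ p u p x - hF.swap₁₂ p u p (N x)
  have r3 : ∀ x, F p p p x + F p p p (N x) + 3 * (F u p p x + F u p p (N x)) +
      3 * (F u u p x + F u u p (N x)) + F u u u (N x) = 0 := fun x => by
    have := hA u u u x
    simp only [LinearMap.add_apply, Module.End.one_apply, hpu, map_add] at this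
    have s1 : ∀ y, F p u u y = F u u p y := fun y => by rw [hF.swap₁₂, hF.swap₂₃]
    have s2 : ∀ y, F p u p y = F u p p y := fun y => by rw [hF.swap₁₂]
    have s3 : ∀ y, F p p u y = F u p p y := fun y => by rw [hF.swap₂₃, hF.swap₁₂]
    have s4 : ∀ y, F u p u y = F u u p y := fun y => by rw [hF.swap₂₃]
    simp only [s1, s2, s3, s4] at this
    linear_combination this
  have hδ : ∀ x, F u u u (N (N (N x))) = 0 := by
    intro x
    obtain ⟨c, hc⟩ := hN3 x
    have a1 := r1 p
    have a2 := r2 p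
    have a3 := r3 p
    have a4 := r3 u
    rw [hNp] at a1 a2 a3
    rw [hpu, hF.swap₃₄ p p p u, hF.swap₃₄ u p p u, hF.swap₃₄ u u p u,
      hF.swap₂₃ p p u p, hF.swap₁₂ p u p p, hF.swap₂₃ u p u p] at a4
    simp only [map_zero, add_zero] at a1 a2 a3
    rw [hc, map_smul, smul_eq_mul]
    have : F u u u p = 0 := by
      linear_combination (1 / 4 : k) * a4 - (1 / 2 : k) * a3 + (1 / 4 : k) * a2
    rw [this, mul_zero]
  have r13 := r1 (N (N (N w)))
  have r23 := r2 (N (N (N w)))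
  have r33 := r3 (N (N (N w)))
  have r12 := r1 (N (N w))
  have r22 := r2 (N (N w))
  have r32 := r3 (N (N w))
  have r11 := r1 (N w)
  have r21 := r2 (N w)
  have r10 := r1 w
  rw [hN4] at r13 r23 r33
  rw [hδ] at r32
  simp only [map_zero, add_zero] at r13 r23 r33
  grind

theorem eq_one_of_forall_hasEigenvalue [IsAlgClosed k] (hF : IsSmoothQuadrilinear F)
    (hdim : finrank k V = 4) (hA : PreservesForm F A) (h : ∀ a, A.HasEigenvalue a → a = 1) :
    A = 1 := by
  refine hA.eq_one_of_sub_one_pow_four hF hdim ?_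
  rw [← hdim]
  refine pow_finrank_eq_zero_of_hasEigenvalue fun a ha => ?_
  obtain ⟨v, hv⟩ := ha.exists_hasEigenvector
  have : A.HasEigenvalue (a + 1) := by
    refine Module.End.hasEigenvalue_of_hasEigenvector (x := v) ⟨?_, hv.2⟩
    rw [Module.End.mem_eigenspace_iff, add_smul, one_smul, ← hv.apply_eq_smul]
    simp
  simpa using h _ this

theorem pow_eq_one [IsAlgClosed k] (hF : IsSmoothQuadrilinear F) (hdim : finrank k V = 4)
    (hA : PreservesForm F A) : A ^ 15120 = 1 := by
  refine (hA.pow _).eq_one_of_forall_hasEigenvalue hF hdim fun b hb => ?_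
  have hmem := Module.End.hasEigenvalue_iff_mem_spectrum.mp hb
  rw [spectrum.map_pow_of_pos A (by norm_num)] at hmem
  obtain ⟨a, ha, rfl⟩ := hmem
  exact hA.eigenvalue_pow_eq_one hF hdim (Module.End.hasEigenvalue_iff_mem_spectrum.mpr ha)

theorem pow_five_eq_one [IsAlgClosed k] (hF : IsSmoothQuadrilinear F) (hdim : finrank k V = 4)
    (hA : PreservesForm F A) (h25 : A ^ 25 = 1) : A ^ 5 = 1 := by
  simpa using pow_gcd_eq_one.mpr ⟨hA.pow_eq_one hF hdim, h25⟩

theorem eq_one_of_hasEigenvalue_one [IsAlgClosed k] (hF : IsSmoothQuadrilinear F)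
    (hdim : finrank k V = 4) (hA : PreservesForm F A) (h5 : A ^ 5 = 1)
    (h1 : A.HasEigenvalue 1) : A = 1 := by
  classical
  refine hA.eq_one_of_forall_hasEigenvalue hF hdim fun a ha => ?_
  by_contra hne
  have ha5 : a ^ 5 = 1 := by
    obtain ⟨v, hv⟩ := ha.exists_hasEigenvector
    exact hv.pow_eq_one h5
  have hprim : IsPrimitiveRoot a 5 := by
    have : Fact (Nat.Prime 5) := ⟨Nat.prime_five⟩
    have := IsPrimitiveRoot.orderOf a
    rwa [orderOf_eq_prime ha5 hne] at this
  have h3 : ∀ {b : k}, b ^ 5 = 1 → A.HasEigenvalue b → A.HasEigenvalue (b ^ 2) := by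
    intro b hb hb'
    convert hA.hasEigenvalue_inv_pow_three hF hb' using 1
    refine eq_inv_of_mul_eq_one_left ?_
    rw [← pow_add, hb]
  have e2 := h3 ha5 ha
  have e4 := h3 (by rw [← pow_mul, mul_comm, pow_mul, ha5, one_pow]) e2
  have e3 := h3 (by
    rw [← pow_mul, ← pow_mul, show 2 * 2 * 5 = 5 * 4 from rfl, pow_mul, ha5, one_pow]) e4
  have hcard := card_hasEigenvalue_le (A := A) ((Finset.range 5).image (a ^ ·)) (by
    intro b hb
    obtain ⟨n, hn, rfl⟩ := Finset.mem_image.mp hb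
    rw [Finset.mem_range] at hn
    interval_cases n
    · simpa using h1
    · simpa using ha
    · exact e2
    · convert e3 using 1
      rw [← pow_mul, ← pow_mul, show 2 * 2 * 2 = 5 + 3 from rfl, pow_add, ha5, one_mul]
    · rwa [← pow_mul] at e4)
  rw [Finset.card_image_of_injOn, Finset.card_range, hdim] at hcard
  · omega
  · intro i hi j hj hij
    exact hprim.pow_inj (by simpa using hi) (by simpa using hj) hij

theorem exists_eq_pow [IsAlgClosed k] (hF : IsSmoothQuadrilinear F)
    (hdim : finrank k V = 4) (hA : PreservesForm F A) (hB : PreservesForm F B)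
    (hAB : Commute A B) (hA25 : A ^ 25 = 1) (hB25 : B ^ 25 = 1) (hA1 : A ≠ 1) :
    ∃ n < 5, B = A ^ n := by
  have hA5 := hA.pow_five_eq_one hF hdim hA25
  have hB5 := hB.pow_five_eq_one hF hdim hB25
  obtain ⟨a, ha, ha1⟩ : ∃ a, A.HasEigenvalue a ∧ a ≠ 1 := by
    by_contra! h
    exact hA1 (hA.eq_one_of_forall_hasEigenvalue hF hdim h)
  have hmaps : ∀ x ∈ A.eigenspace a, B x ∈ A.eigenspace a := fun x hx => by
    rw [Module.End.mem_eigenspace_iff] at hx ⊢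
    rw [← Module.End.mul_apply, hAB.eq, Module.End.mul_apply, hx, map_smul]
  have : Nontrivial (A.eigenspace a) := by
    rw [Submodule.nontrivial_iff_ne_bot]
    exact Module.End.hasEigenvalue_iff.mp ha
  obtain ⟨b, hb⟩ := Module.End.exists_eigenvalue (B.restrict hmaps)
  obtain ⟨⟨v, hv⟩, hvb, hv0⟩ := hb.exists_hasEigenvector
  have hv0 : v ≠ 0 := fun h => hv0 (Subtype.ext h)
  have hBv : B v = b • v := by
    rw [Module.End.mem_eigenspace_iff] at hvb
    exact congr_arg Subtype.val hvb
  have hAvec : A.HasEigenvector a v := ⟨hv, hv0⟩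
  have hBvec : B.HasEigenvector b v := ⟨Module.End.mem_eigenspace_iff.mpr hBv, hv0⟩
  have ha5 := hAvec.pow_eq_one hA5
  have hprim : IsPrimitiveRoot a 5 := by
    have : Fact (Nat.Prime 5) := ⟨Nat.prime_five⟩
    have := IsPrimitiveRoot.orderOf a
    rwa [orderOf_eq_prime ha5 ha1] at this
  obtain ⟨n, hn, rfl⟩ := hprim.eq_pow_of_pow_eq_one (hBvec.pow_eq_one hB5)
  refine ⟨n, hn, ?_⟩
  have hC : B * A ^ (5 - n) = 1 := by
    refine (hB.mul (hA.pow _)).eq_one_of_hasEigenvalue_one hF hdim ?_ ?_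
    · rw [((hAB.symm).pow_right _).mul_pow, hB5, ← pow_mul, mul_comm, pow_mul, hA5, one_pow,
        one_mul]
    · refine Module.End.hasEigenvalue_of_hasEigenvector (x := v) ⟨?_, hv0⟩
      rw [Module.End.mem_eigenspace_iff, Module.End.mul_apply, hAvec.pow_apply, map_smul, hBv,
        smul_smul, ← pow_add, Nat.sub_add_cancel hn.le, ha5]
  calc B = B * (A ^ (5 - n) * A ^ n) := by
        rw [← pow_add, Nat.sub_add_cancel hn.le, hA5, mul_one]
    _ = A ^ n := by rw [← mul_assoc, hC, one_mul]

end PreservesForm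

end Quadrilinear

/-- **Burnside's theorem** for linear groups of finite exponent in characteristic zero. -/
theorem Submonoid.finite_of_forall_pow_eq_one {k V : Type*} [Field k] [AddCommGroup V] [Module k V]
    [IsAlgClosed k] [CharZero k] [FiniteDimensional k V] (G : Submonoid (Module.End k V)) {N : ℕ}
    (hN : 0 < N) (hG : ∀ A ∈ G, A ^ N = 1) : (G : Set (Module.End k V)).Finite := by
  classical
  set T : Set k := LinearMap.trace k V '' G with hT
  have hTfin : T.Finite := by
    have hroots : ∀ A ∈ G, ∀ a ∈ A.charpoly.roots, a ∈ Polynomial.nthRootsFinset N (1 : k) := by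
      intro A hA a ha
      rw [Polynomial.mem_nthRootsFinset hN]
      obtain ⟨v, hv⟩ := ((Module.End.hasEigenvalue_iff_isRoot_charpoly A a).mpr
        (Polynomial.isRoot_of_mem_roots ha)).exists_hasEigenvector
      exact hv.pow_eq_one (hG A hA)
    refine (Set.finite_range
      fun c : Polynomial.nthRootsFinset N (1 : k) → Fin (Module.finrank k V + 1) =>
        ∑ a, (c a : ℕ) • (a : k)).subset ?_
    rintro _ ⟨A, hA, rfl⟩
    have hcard : A.charpoly.roots.card = Module.finrank k V := by
      rw [← (IsAlgClosed.splits A.charpoly).natDegree_eq_card_roots, LinearMap.charpoly_natDegree]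
    refine ⟨fun a => ⟨A.charpoly.roots.count (a : k), ?_⟩, ?_⟩
    · rw [Nat.lt_succ_iff, ← hcard]
      exact Multiset.count_le_card _ _
    · rw [Module.End.trace_eq_sum_roots_charpoly_of_splits (IsAlgClosed.splits _)]
      simp only
      rw [Finset.sum_coe_sort (Polynomial.nthRootsFinset N (1 : k))
        fun a => A.charpoly.roots.count a • a, ← Finset.sum_multiset_count_of_subset]
      intro a ha
      exact hroots A hA a (Multiset.mem_toFinset.mp ha)
  obtain ⟨b, hbG, hspan, hli⟩ := exists_linearIndependent k (G : Set (Module.End k V))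
  have hbfin : Finite b := hli.setFinite
  refine Set.Finite.of_injOn (f := fun A => fun c : b => LinearMap.trace k V (A * c))
    (t := Set.pi Set.univ fun _ => T) ?_ ?_ (Set.Finite.pi fun _ => hTfin)
  · intro A hA c _
    exact ⟨A * c, G.mul_mem hA (hbG c.2), rfl⟩
  · intro A hA B hB hAB
    have htr : ∀ C ∈ G, LinearMap.trace k V (A * C) = LinearMap.trace k V (B * C) := fun C hC =>
      LinearMap.eqOn_span (f := LinearMap.trace k V ∘ₗ LinearMap.mulLeft k A)
        (g := LinearMap.trace k V ∘ₗ LinearMap.mulLeft k B) (fun c hc => congr_fun hAB ⟨c, hc⟩)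
        (hspan ▸ Submodule.subset_span hC)
    have hB1 : B * B ^ (N - 1) = 1 := by rw [mul_pow_sub_one hN.ne', hG B hB]
    have hB2 : B ^ (N - 1) * B = 1 := by rw [pow_sub_one_mul hN.ne', hG B hB]
    set g := A * B ^ (N - 1) with hg
    have hgG : g ∈ G := G.mul_mem hA (G.pow_mem hB _)
    have hgtr : ∀ j, LinearMap.trace k V (g ^ j) = Module.finrank k V := by
      intro j
      induction j with
      | zero => simp
      | succ j ih =>
        rw [pow_succ', hg, mul_assoc, htr _ (G.mul_mem (G.pow_mem hB _) (G.pow_mem hgG j)),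
          ← mul_assoc, hB1, one_mul, ih]
    have hNk : (N : k) ≠ 0 := Nat.cast_ne_zero.mpr hN.ne'
    set e : Module.End k V := (N : k)⁻¹ • ∑ j ∈ Finset.range N, g ^ j with he
    have hge : g * e = e := by
      rw [he, mul_smul_comm, Finset.mul_sum]
      congr 1
      have h1 := Finset.sum_range_succ (fun j => g ^ j) N
      rw [Finset.sum_range_succ', hG g hgG, pow_zero] at h1
      simpa [pow_succ'] using h1
    have hgje : ∀ j, g ^ j * e = e := by
      intro j
      induction j with
      | zero => simp
      | succ j ih => rw [pow_succ, mul_assoc, hge, ih]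
    have hidem : IsIdempotentElem e := by
      change ((N : k)⁻¹ • ∑ j ∈ Finset.range N, g ^ j) * e = e
      rw [smul_mul_assoc, Finset.sum_mul]
      simp only [hgje, Finset.sum_const, Finset.card_range]
      rw [← Nat.cast_smul_eq_nsmul k, smul_smul, inv_mul_cancel₀ hNk, one_smul]
    have he1 : 1 - e = 0 := by
      refine LinearMap.IsIdempotentElem.eq_zero_of_trace_eq_zero hidem.one_sub ?_
      rw [map_sub, he, map_smul, map_sum]
      simp [hgtr, hNk]
    have hg1 : g = 1 := by
      rw [← mul_one g, sub_eq_zero.mp he1, hge]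
    calc A = g * B := by rw [hg, mul_assoc, hB2, mul_one]
      _ = B := by rw [hg1, one_mul]

section Polarization

open Module

variable {k V : Type*} [Field k] [CharZero k] [AddCommGroup V] [Module k V]
  {F : V →ₗ[k] V →ₗ[k] V →ₗ[k] V →ₗ[k] k} {A : End k V}

theorem IsSmoothQuadrilinear.preservesForm (hF : IsSmoothQuadrilinear F)
    (hA : ∀ x, F (A x) (A x) (A x) (A x) = F x x x x) : PreservesForm F A := by
  have s₁ : ∀ x y, F x x y x = F x x x y := fun x y => hF.swap₃₄ _ _ _ _
  have s₂ : ∀ x y z, F x y x z = F x x y z := fun x y z => hF.swap₂₃ _ _ _ _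
  have s₃ : ∀ x y z, F y x x z = F x x y z := fun x y z => by rw [hF.swap₁₂, hF.swap₂₃]
  have hsub : ∀ x y a b c, F (x - y) a b c = F x a b c - F y a b c := by
    intro x y a b c
    rw [sub_eq_add_neg, ← neg_one_smul k, map_add, map_smul]
    simp [sub_eq_add_neg]
  have h₃ : ∀ x y, F (A x) (A x) (A x) (A y) = F x x x y := by
    intro x y
    have e : ∀ x y, 48 * F x x x y =
        8 * (F (x + y) (x + y) (x + y) (x + y) - F (x - y) (x - y) (x - y) (x - y)) -
        (F (x + y + y) (x + y + y) (x + y + y) (x + y + y) -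
          F (x - y - y) (x - y - y) (x - y - y) (x - y - y)) := by
      intro x y
      simp only [hsub, map_add, map_sub, LinearMap.add_apply, LinearMap.sub_apply, s₂, s₃, s₁]
      ring
    have e1 := e (A x) (A y)
    simp only [← map_add, ← map_sub, hA] at e1
    have e2 := e x y
    exact mul_left_cancel₀ (by norm_num : (48 : k) ≠ 0) (e1.trans e2.symm)
  have h₂ : ∀ x z y, F (A x) (A x) (A z) (A y) = F x x z y := by
    intro x z y
    have e : ∀ x z y, 6 * F x x z y = F (x + z) (x + z) (x + z) y - F (x - z) (x - z) (x - z) y -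
        2 * F z z z y := by
      intro x z y
      simp only [hsub, map_add, map_sub, LinearMap.add_apply, LinearMap.sub_apply, s₂, s₃]
      ring
    have e1 := e (A x) (A z) (A y)
    simp only [← map_add, ← map_sub, h₃] at e1
    exact mul_left_cancel₀ (by norm_num : (6 : k) ≠ 0) (e1.trans (e x z y).symm)
  intro x w z y
  have e : ∀ x w z y, 4 * F x w z y = F (x + w) (x + w) z y - F (x - w) (x - w) z y := by
    intro x w z y
    simp only [hsub, map_add, map_sub, LinearMap.add_apply, LinearMap.sub_apply, hF.swap₁₂ w x]
    ring
  have e1 := e (A x) (A w) (A z) (A y)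
  simp only [← map_add, ← map_sub, h₂] at e1
  exact mul_left_cancel₀ (by norm_num : (4 : k) ≠ 0) (e1.trans (e x w z y).symm)

end Polarization

theorem Fintype.linearCombination_swap {k W ι : Type*} [Field k] [AddCommGroup W] [Module k W]
    [Fintype ι] {g : ι → ι → W} (hg : ∀ i j, g i j = g j i) (x y : ι → k) :
    Fintype.linearCombination k (fun i => Fintype.linearCombination k (g i)) x y =
      Fintype.linearCombination k (fun i => Fintype.linearCombination k (g i)) y x := by
  simp only [Fintype.linearCombination_apply, LinearMap.sum_apply, LinearMap.smul_apply,
    Finset.smul_sum]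
  rw [Finset.sum_comm]
  refine Finset.sum_congr rfl fun i _ => Finset.sum_congr rfl fun j _ => ?_
  rw [hg, smul_comm]

namespace MvPolynomial

theorem pderiv_pderiv_comm {σ R : Type*} [CommRing R] (i j : σ) (f : MvPolynomial σ R) :
    pderiv i (pderiv j f) = pderiv j (pderiv i f) := by
  classical
  have h : ⁅pderiv (R := R) i, pderiv j⁆ = 0 := derivation_ext fun l => by
    rw [Derivation.commutator_apply]
    simp [pderiv_X, Pi.single_apply, apply_ite]
  have := congr($h f)
  rw [Derivation.commutator_apply] at this
  simpa [sub_eq_zero] using this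

variable {k : Type*} [Field k] {f : MvPolynomial (Fin 4) k}

theorem IsHomogeneous.linearCombination_eval_pderiv {n : ℕ} (hf : f.IsHomogeneous n)
    (x : Fin 4 → k) :
    Fintype.linearCombination k (fun i => eval x (pderiv i f)) x = n * eval x f := by
  have := congr(eval x $(hf.sum_X_mul_pderiv))
  simpa [Fintype.linearCombination_apply] using this

/-- The quadrilinear form given by the fourth derivative of `f` at the origin. -/
noncomputable def fourthDeriv (f : MvPolynomial (Fin 4) k) :
    (Fin 4 → k) →ₗ[k] (Fin 4 → k) →ₗ[k] (Fin 4 → k) →ₗ[k] (Fin 4 → k) →ₗ[k] k :=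
  Fintype.linearCombination k fun i => Fintype.linearCombination k fun j =>
    Fintype.linearCombination k fun l => Fintype.linearCombination k fun m =>
      eval 0 (pderiv m (pderiv l (pderiv j (pderiv i f))))

theorem fourthDeriv_swap₁₂ (x y z w : Fin 4 → k) :
    fourthDeriv f x y z w = fourthDeriv f y x z w := by
  have h := Fintype.linearCombination_swap (k := k)
    (g := fun i j => Fintype.linearCombination k fun l => Fintype.linearCombination k fun m =>
      eval 0 (pderiv m (pderiv l (pderiv j (pderiv i f)))))
    (fun i j => by simp_rw [pderiv_pderiv_comm i j]) x y
  exact congr($h z w)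

theorem fourthDeriv_swap₂₃ (x y z w : Fin 4 → k) :
    fourthDeriv f x y z w = fourthDeriv f x z y w := by
  simp only [fourthDeriv, Fintype.linearCombination_apply _ _ x, LinearMap.sum_apply,
    LinearMap.smul_apply]
  refine Finset.sum_congr rfl fun i _ => ?_
  have h := Fintype.linearCombination_swap (k := k)
    (g := fun j l => Fintype.linearCombination k fun m =>
      eval 0 (pderiv m (pderiv l (pderiv j (pderiv i f)))))
    (fun j l => by simp_rw [pderiv_pderiv_comm j l]) y z
  exact congr(x i • $h w)

theorem fourthDeriv_swap₃₄ (x y z w : Fin 4 → k) :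
    fourthDeriv f x y z w = fourthDeriv f x y w z := by
  simp only [fourthDeriv, Fintype.linearCombination_apply _ _ x,
    Fintype.linearCombination_apply _ _ y, LinearMap.sum_apply, LinearMap.smul_apply]
  refine Finset.sum_congr rfl fun i _ => ?_
  congr 1
  refine Finset.sum_congr rfl fun j _ => ?_
  congr 1
  refine Fintype.linearCombination_swap (fun l m => ?_) z w
  rw [pderiv_pderiv_comm]

theorem IsHomogeneous.fourthDeriv_apply (hf : f.IsHomogeneous 4) (w x : Fin 4 → k) :
    fourthDeriv f w x x x = 6 * ∑ i, w i * eval x (pderiv i f) := by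
  have h0 : ∀ g : MvPolynomial (Fin 4) k, g.IsHomogeneous 0 → eval 0 g = eval x g := by
    intro g hg
    rw [← totalDegree_zero_iff_isHomogeneous, totalDegree_eq_zero_iff_eq_C] at hg
    rw [hg, eval_C, eval_C]
  simp only [fourthDeriv, Fintype.linearCombination_apply _ _ w, LinearMap.sum_apply,
    LinearMap.smul_apply, Finset.mul_sum]
  refine Finset.sum_congr rfl fun i _ => ?_
  have h3 : (pderiv i f).IsHomogeneous 3 := hf.pderiv
  rw [smul_eq_mul, mul_left_comm]
  congr 1
  have h2 : ∀ j, (pderiv j (pderiv i f)).IsHomogeneous 2 := fun j => h3.pderiv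
  have h1 : ∀ j l, (pderiv l (pderiv j (pderiv i f))).IsHomogeneous 1 := fun j l => (h2 j).pderiv
  simp only [fun j l m => h0 _ ((h1 j l).pderiv (i := m))]
  have e3 := h3.linearCombination_eval_pderiv x
  simp only [Fintype.linearCombination_apply _ _ x, LinearMap.sum_apply,
    LinearMap.smul_apply, smul_eq_mul] at e3 ⊢
  calc _ = ∑ j, x j * ∑ l, x l * eval x (pderiv l (pderiv j (pderiv i f))) := by
        refine Finset.sum_congr rfl fun j _ => ?_
        congr 1
        refine Finset.sum_congr rfl fun l _ => ?_
        congr 1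
        simpa [Fintype.linearCombination_apply] using (h1 j l).linearCombination_eval_pderiv x
    _ = ∑ j, 2 * (x j * eval x (pderiv j (pderiv i f))) := by
        refine Finset.sum_congr rfl fun j _ => ?_
        rw [mul_left_comm]
        congr 1
        simpa [Fintype.linearCombination_apply] using (h2 j).linearCombination_eval_pderiv x
    _ = 6 * eval x (pderiv i f) := by
        rw [← Finset.mul_sum, e3]
        push_cast
        ring

theorem IsHomogeneous.fourthDeriv_self (hf : f.IsHomogeneous 4) (x : Fin 4 → k) :
    fourthDeriv f x x x x = 24 * eval x f := by
  have := hf.linearCombination_eval_pderiv x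
  simp only [Fintype.linearCombination_apply, smul_eq_mul] at this
  rw [hf.fourthDeriv_apply, this]
  push_cast
  ring

theorem IsHomogeneous.isSmoothQuadrilinear_fourthDeriv [CharZero k] (hf : f.IsHomogeneous 4)
    (hns : ¬ f.IsSingularForm) : IsSmoothQuadrilinear (fourthDeriv f) where
  swap₁₂ := fourthDeriv_swap₁₂
  swap₂₃ := fourthDeriv_swap₂₃
  swap₃₄ := fourthDeriv_swap₃₄
  smooth p hp := by
    by_contra! h
    refine hns ⟨p, hp, fun i => ?_⟩
    have := h (Pi.single i 1)
    rw [fourthDeriv_swap₃₄, fourthDeriv_swap₂₃, fourthDeriv_swap₁₂, hf.fourthDeriv_apply] at this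
    simpa [Pi.single_apply] using this

end MvPolynomial

theorem eval_substM {k : Type*} [CommSemiring k] (A : Matrix (Fin 4) (Fin 4) k)
    (f : MvPolynomial (Fin 4) k) (x : Fin 4 → k) :
    eval x (substM A f) = eval (A.mulVec x) f := by
  rw [substM, ← aeval_eq_eval, ← aeval_eq_eval, ← AlgHom.comp_apply, comp_aeval]
  congr 2
  ext i
  simp [Matrix.mulVec, dotProduct]

section FormGroup

open Module

variable {k : Type*} [Field k]

/-- The group of invertible matrices preserving a quadrilinear form. -/
def quadrilinearFormGroup
    (F : (Fin 4 → k) →ₗ[k] (Fin 4 → k) →ₗ[k] (Fin 4 → k) →ₗ[k] (Fin 4 → k) →ₗ[k] k) :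
    Subgroup (Matrix.GeneralLinearGroup (Fin 4) k) where
  carrier := {A | PreservesForm F (Matrix.toLinAlgEquiv' (A : Matrix (Fin 4) (Fin 4) k))}
  one_mem' := by simpa using PreservesForm.one
  mul_mem' hA hB := by simpa using PreservesForm.mul hA hB
  inv_mem' {A} hA x y z w := by
    have h : ∀ v : Fin 4 → k, Matrix.toLinAlgEquiv' (A : Matrix (Fin 4) (Fin 4) k)
        (Matrix.toLinAlgEquiv' ((A⁻¹ : Matrix.GeneralLinearGroup (Fin 4) k) :
          Matrix (Fin 4) (Fin 4) k) v) = v := fun v => by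
      rw [← Module.End.mul_apply, ← map_mul, ← Units.val_mul, mul_inv_cancel, Units.val_one,
        map_one, Module.End.one_apply]
    rw [← hA, h, h, h, h]

variable {F : (Fin 4 → k) →ₗ[k] (Fin 4 → k) →ₗ[k] (Fin 4 → k) →ₗ[k] (Fin 4 → k) →ₗ[k] k}

theorem toLinAlgEquiv'_units_injective : Function.Injective
    fun A : Matrix.GeneralLinearGroup (Fin 4) k =>
      Matrix.toLinAlgEquiv' (A : Matrix (Fin 4) (Fin 4) k) :=
  Matrix.toLinAlgEquiv'.injective.comp Units.val_injective

variable [IsAlgClosed k] [CharZero k]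

theorem IsSmoothQuadrilinear.finite_quadrilinearFormGroup (hF : IsSmoothQuadrilinear F) :
    Finite (quadrilinearFormGroup F) := by
  let G : Submonoid (End k (Fin 4 → k)) :=
    { carrier := {A | PreservesForm F A}
      one_mem' := PreservesForm.one
      mul_mem' := PreservesForm.mul }
  have hG : (G : Set (End k (Fin 4 → k))).Finite :=
    G.finite_of_forall_pow_eq_one (N := 15120) (by norm_num) fun A hA =>
      PreservesForm.pow_eq_one hF (by simp) hA
  exact (hG.preimage toLinAlgEquiv'_units_injective.injOn).to_subtype

theorem IsSmoothQuadrilinear.not_dvd_card_quadrilinearFormGroup (hF : IsSmoothQuadrilinear F) :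
    ¬ 25 ∣ Nat.card (quadrilinearFormGroup F) := by
  intro hdvd
  have := hF.finite_quadrilinearFormGroup
  have : Fact (Nat.Prime 5) := ⟨Nat.prime_five⟩
  obtain ⟨P, hP⟩ := Sylow.exists_subgroup_card_pow_prime 5 (n := 2) hdvd
  let φ : P → End k (Fin 4 → k) := fun g =>
    Matrix.toLinAlgEquiv' (((g : quadrilinearFormGroup F) :
      Matrix.GeneralLinearGroup (Fin 4) k) : Matrix (Fin 4) (Fin 4) k)
  have hφinj : Function.Injective φ :=
    toLinAlgEquiv'_units_injective.comp (Subtype.val_injective.comp Subtype.val_injective)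
  have hφone : φ 1 = 1 := by simp [φ]
  have hφmul : ∀ g h, φ (g * h) = φ g * φ h := fun g h => by simp [φ]
  have hφpow : ∀ g (n : ℕ), φ (g ^ n) = φ g ^ n := fun g n => by simp [φ]
  have hφ25 : ∀ g, φ g ^ 25 = 1 := fun g => by
    have h : g ^ 5 ^ 2 = 1 := hP ▸ pow_card_eq_one'
    rw [← hφpow, ← hφone, ← h]
    norm_num
  have hcomm := IsPGroup.isMulCommutative_of_card_eq_prime_sq hP
  have : Nontrivial P := by
    rw [← Finite.one_lt_card_iff_nontrivial, hP]
    norm_num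
  obtain ⟨g, hg⟩ := exists_ne (1 : P)
  have hsurj : Function.Surjective fun n : Fin 5 => g ^ (n : ℕ) := by
    intro h
    have hgh : Commute (φ g) (φ h) := by
      rw [Commute, SemiconjBy, ← hφmul, ← hφmul, hcomm.is_comm.comm]
    obtain ⟨n, hn, hgn⟩ := PreservesForm.exists_eq_pow hF (by simp) g.1.2 h.1.2 hgh (hφ25 g)
      (hφ25 h) fun h1 => hg (hφinj (h1.trans hφone.symm))
    exact ⟨⟨n, hn⟩, hφinj ((hφpow _ _).trans hgn.symm)⟩
  have := Nat.card_le_card_of_surjective _ hsurj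
  rw [hP, Nat.card_fin] at this
  norm_num at this

end FormGroup

section Paut

variable {k : Type*} [Field k] [CharZero k] {f : MvPolynomial (Fin 4) k}

theorem mem_quadrilinearFormGroup_fourthDeriv (hhom : f.IsHomogeneous 4)
    (hns : ¬ f.IsSingularForm) {A : Matrix.GeneralLinearGroup (Fin 4) k} :
    A ∈ quadrilinearFormGroup (fourthDeriv f) ↔
      ∀ x, eval ((A : Matrix (Fin 4) (Fin 4) k).mulVec x) f = eval x f := by
  have h24 : (24 : k) ≠ 0 := by norm_num
  constructor
  · intro hA x
    have h := hA x x x x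
    rw [hhom.fourthDeriv_self, hhom.fourthDeriv_self] at h
    exact mul_left_cancel₀ h24 h
  · intro hA
    refine (hhom.isSmoothQuadrilinear_fourthDeriv hns).preservesForm fun x => ?_
    rw [hhom.fourthDeriv_self, hhom.fourthDeriv_self]
    exact congr_arg _ (hA x)

theorem isProjAut_of_mem_quadrilinearFormGroup (hhom : f.IsHomogeneous 4)
    (hns : ¬ f.IsSingularForm) {A : Matrix.GeneralLinearGroup (Fin 4) k}
    (hA : A ∈ quadrilinearFormGroup (fourthDeriv f)) : IsProjAut f A := by
  refine ⟨1, funext fun x => ?_⟩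
  rw [eval_substM, Units.val_one, one_smul]
  exact (mem_quadrilinearFormGroup_fourthDeriv hhom hns).mp (inv_mem hA) x

theorem MvPolynomial.IsHomogeneous.eval_smul_of_four (hhom : f.IsHomogeneous 4) (s : k)
    (x : Fin 4 → k) : eval (s • x) f = s ^ 4 * eval x f := by
  have h := hhom.fourthDeriv_self (s • x)
  simp only [map_smul, LinearMap.smul_apply, hhom.fourthDeriv_self, smul_eq_mul] at h
  refine mul_left_cancel₀ (by norm_num : (24 : k) ≠ 0) (h.symm.trans ?_)
  ring

theorem IsProjAut.exists_mem_quadrilinearFormGroup [IsAlgClosed k] (hhom : f.IsHomogeneous 4)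
    (hns : ¬ f.IsSingularForm) {A : Matrix.GeneralLinearGroup (Fin 4) k} (hA : IsProjAut f A) :
    ∃ B ∈ quadrilinearFormGroup (fourthDeriv f),
      (QuotientGroup.mk B : Matrix.GeneralLinearGroup (Fin 4) k ⧸
        Subgroup.center (Matrix.GeneralLinearGroup (Fin 4) k)) = QuotientGroup.mk A := by
  obtain ⟨c, hc⟩ := hA
  obtain ⟨s, hs⟩ := IsAlgClosed.exists_pow_nat_eq (c : k) (n := 4) (by norm_num)
  have hs0 : s ≠ 0 := by
    rintro rfl
    exact c.ne_zero (by simpa using hs.symm)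
  let S : Matrix.GeneralLinearGroup (Fin 4) k :=
    Matrix.GeneralLinearGroup.scalar (Fin 4) (Units.mk0 s hs0)
  have hS : S ∈ Subgroup.center (Matrix.GeneralLinearGroup (Fin 4) k) := by
    rw [Matrix.GeneralLinearGroup.mem_center_iff_val_mem_range_scalar]
    exact ⟨s, rfl⟩
  refine ⟨A * S, (mem_quadrilinearFormGroup_fourthDeriv hhom hns).mpr fun x => ?_, ?_⟩
  · have h := congr_arg (eval ((A : Matrix (Fin 4) (Fin 4) k).mulVec x)) hc
    rw [eval_substM, Matrix.mulVec_mulVec, ← Units.val_mul, inv_mul_cancel, Units.val_one,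
      Matrix.one_mulVec, smul_eval] at h
    have hSx : (S : Matrix (Fin 4) (Fin 4) k).mulVec x = s • x := by
      simp [S]
    rw [Units.val_mul, ← Matrix.mulVec_mulVec, hSx, Matrix.mulVec_smul, hhom.eval_smul_of_four,
      hs, h]
  · rw [QuotientGroup.eq]
    simpa using inv_mem hS

theorem pautCard_eq_card_map [IsAlgClosed k] (hhom : f.IsHomogeneous 4)
    (hns : ¬ f.IsSingularForm) :
    pautCard f = Nat.card ((quadrilinearFormGroup (fourthDeriv f)).map
      (QuotientGroup.mk' (Subgroup.center (Matrix.GeneralLinearGroup (Fin 4) k)))) := by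
  refine Nat.card_congr (Equiv.subtypeEquivRight fun x => ?_)
  constructor
  · rintro ⟨A, rfl, hA⟩
    exact hA.exists_mem_quadrilinearFormGroup hhom hns
  · rintro ⟨A, hA, rfl⟩
    exact ⟨A, rfl, isProjAut_of_mem_quadrilinearFormGroup hhom hns hA⟩

end Paut

/-- for a nonsingular quartic form `f ∈ k[x,y,z,t]`, `25` does not divide
`|Paut(f)|`: the exponent of `5` in the prime factorization of `|Paut(f)|` is at most 1. -/
theorem stmt_11 {k : Type*} [Field k] [IsAlgClosed k] [CharZero k]
    (f : MvPolynomial (Fin 4) k) (hhom : f.IsHomogeneous 4) (hf : f ≠ 0)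
    (hns : ¬ f.IsSingularForm) :
    ¬ (25 ∣ pautCard f) := by
  intro hdvd
  rw [pautCard_eq_card_map hhom hns] at hdvd
  exact (hhom.isSmoothQuadrilinear_fourthDeriv hns).not_dvd_card_quadrilinearFormGroup
    (hdvd.trans (Subgroup.card_map_dvd _ _))
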